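/- Let p be an odd prime and let a be an integer with 1 ≤ a ≤ p−1. Then Σ_{i=1}^{p−2} B_i/(i·a^i) ≡ q_a + w_p (mod p), where q_a = (a^{p−1} − 1)/p is the Fermat quotient of p in base a and w_p = ((p−1)! + 1)/p is the Wilson quotient. -/

import Mathlib

/-- `x ≡ y (mod p^r)` for rationals: `x - y = p^r * t` with the denominator of `t`
prime to `p`, i.e. the `p`-adic valuation of `x - y` is at least `r`. -/
def ratCongr (p r : ℕ) (x y : ℚ) : Prop :=
  ∃ t : ℚ, x - y = (p : ℚ) ^ r * t ∧ ¬ (p ∣ t.den)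

open Finset

theorem aux_prod (p : ℤ) (n : ℕ) (f : ℕ → ℤ) :
    ∃ c : ℤ, ∏ i ∈ range n, (1 + p * f i) = 1 + p * ∑ i ∈ range n, f i + p ^ 2 * c := by
  induction n with
  | zero => exact ⟨0, by simp⟩
  | succ n ih =>
    obtain ⟨c, hc⟩ := ih
    refine ⟨c + c * p * f n + (∑ i ∈ range n, f i) * f n, ?_⟩
    rw [prod_range_succ, sum_range_succ, hc]
    ring

theorem aux_choose (p : ℕ) (hp : p.Prime) (j : ℕ) (hj : j < p) :
    ∃ c : ℤ, ((p - 1).choose j : ℤ) = (-1) ^ j + p * c := by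
  induction j with
  | zero => exact ⟨0, by simp⟩
  | succ j ih =>
    obtain ⟨c, hc⟩ := ih (by omega)
    obtain ⟨d, hd⟩ := hp.dvd_choose_self (k := j + 1) (by omega) hj
    have h : p.choose (j + 1) = (p - 1).choose j + (p - 1).choose (j + 1) := by
      obtain ⟨m, rfl⟩ : ∃ m, p = m + 1 := ⟨p - 1, by omega⟩
      simp [Nat.choose_succ_succ]
    refine ⟨d - c, ?_⟩
    have : (p.choose (j + 1) : ℤ) = p * d := by exact_mod_cast hd
    rw [h] at this
    push_cast at this
    rw [pow_succ]
    linarith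

theorem aux_fermat (p : ℕ) (hp : p.Prime) (k : ℕ) (h1 : 1 ≤ k) (h2 : k < p) :
    (k : ℤ) ^ (p - 1) = 1 + p * (((k : ℤ) ^ (p - 1) - 1) / p) := by
  have hc : IsCoprime (k : ℤ) p := by
    rw [Nat.isCoprime_iff_coprime]
    exact ((Nat.Prime.coprime_iff_not_dvd hp).2 (Nat.not_dvd_of_pos_of_lt (by omega) h2)).symm
  have := (Int.ModEq.pow_card_sub_one_eq_one hp hc).symm.dvd
  rw [Int.mul_ediv_cancel' this]
  ring

theorem aux_fermatQ (p : ℕ) (hp : p.Prime) (k : ℕ) (h1 : 1 ≤ k) (h2 : k < p) :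
    (k : ℚ) ^ (p - 1) = 1 + p * ((((k : ℤ) ^ (p - 1) - 1) / (p : ℤ) : ℤ) : ℚ) := by
  have h := aux_fermat p hp k h1 h2
  generalize ((k : ℤ) ^ (p - 1) - 1) / (p : ℤ) = q at h ⊢
  exact_mod_cast congrArg (Int.cast : ℤ → ℚ) h

theorem aux_wilson (p : ℕ) (hp : p.Prime) :
    (((p - 1).factorial : ℕ) : ℤ) = -1 + p * (((((p - 1).factorial : ℕ) : ℤ) + 1) / p) := by
  have : Fact p.Prime := ⟨hp⟩
  have h : (p : ℤ) ∣ (((p - 1).factorial : ℕ) : ℤ) + 1 := by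
    rw [← ZMod.intCast_zmod_eq_zero_iff_dvd]
    push_cast
    rw [ZMod.wilsons_lemma]
    ring
  rw [Int.mul_ediv_cancel' h]
  ring

theorem aux_lerch (p : ℕ) (hp : p.Prime) (hodd : Odd p) :
    ∃ c : ℤ, ∑ k ∈ range (p - 1), ((((k + 1 : ℕ) : ℤ) ^ (p - 1) - 1) / p) =
      ((((p - 1).factorial : ℕ) : ℤ) + 1) / p + p * c := by
  set w : ℤ := ((((p - 1).factorial : ℕ) : ℤ) + 1) / p with hw
  set Q : ℕ → ℤ := fun k => (((k + 1 : ℕ) : ℤ) ^ (p - 1) - 1) / p with hQ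
  have hpp := hp.two_le
  have hW := aux_wilson p hp
  rw [← hw] at hW
  have e1 : ∏ k ∈ range (p - 1), (1 + (p : ℤ) * Q k) = (((p - 1).factorial : ℕ) : ℤ) ^ (p - 1) := by
    rw [← prod_range_add_one_eq_factorial, Nat.cast_prod, ← prod_pow]
    refine prod_congr rfl fun k hk => ?_
    rw [mem_range] at hk
    exact (aux_fermat p hp (k + 1) (by omega) (by omega)).symm
  have hev : Even (p - 1) := Nat.Odd.sub_odd hodd odd_one
  obtain ⟨c, hc⟩ := aux_prod p (p - 1) Q
  obtain ⟨d, hd⟩ := aux_prod p (p - 1) (fun _ => -w)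
  have e2 : ∏ k ∈ range (p - 1), (1 + (p : ℤ) * (-w)) = (((p - 1).factorial : ℕ) : ℤ) ^ (p - 1) := by
    rw [prod_const, card_range, hW, ← hev.neg_pow]
    congr 1
    ring
  rw [e1] at hc
  rw [e2, hc] at hd
  simp only [sum_const, card_range, nsmul_eq_mul] at hd
  rw [Nat.cast_sub (by omega)] at hd
  refine ⟨d - c - w, ?_⟩
  have hp0 : (p : ℤ) ≠ 0 := by exact_mod_cast hp.ne_zero
  apply mul_left_cancel₀ hp0
  push_cast at hd
  change (p : ℤ) * ∑ k ∈ range (p - 1), Q k = _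
  linear_combination hd

theorem aux_faul (m n : ℕ) :
    ∑ k ∈ range n, (k : ℚ) ^ (m + 1) = (n : ℚ) ^ (m + 2) / ((m + 2 : ℕ) : ℚ) + bernoulli (m + 1) * n
      + ∑ j ∈ range m, bernoulli (j + 1) / ((j + 1 : ℕ) : ℚ) * ((m + 1).choose j : ℚ)
          * (n : ℚ) ^ (m + 1 - j) := by
  rw [sum_range_pow, sum_range_succ, sum_range_succ']
  have h2 : ((m : ℚ) + 1 + 1) ≠ 0 := by positivity
  have e : ∀ j ∈ range m, bernoulli (j + 1) * ((m + 1 + 1).choose (j + 1) : ℚ) *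
      (n : ℚ) ^ (m + 1 + 1 - (j + 1)) / (((m + 1 : ℕ) : ℚ) + 1) =
      bernoulli (j + 1) / ((j + 1 : ℕ) : ℚ) * ((m + 1).choose j : ℚ) * (n : ℚ) ^ (m + 1 - j) := by
    intro j _
    have h := Nat.add_one_mul_choose_eq (m + 1) j
    have h' : ((m : ℚ) + 1 + 1) * ((m + 1).choose j : ℚ)
        = ((m + 1 + 1).choose (j + 1) : ℚ) * ((j : ℚ) + 1) := by exact_mod_cast h
    have hj : ((j : ℚ) + 1) ≠ 0 := by positivity
    have hx : m + 1 + 1 - (j + 1) = m + 1 - j := by omega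
    rw [hx]
    push_cast
    field_simp
    linear_combination (-(bernoulli (j + 1)) * (n : ℚ) ^ (m + 1 - j)) * h'
  rw [sum_congr rfl e]
  have hx : m + 1 + 1 - (m + 1) = 1 := by omega
  rw [hx]
  simp [Nat.choose_succ_self_right]
  field_simp
  ring

/-- the ring of p-integral rationals -/
def pInt (p : ℕ) [Fact p.Prime] : Subring ℚ := (Rat.padicValuation p).integer

theorem mem_pInt (p : ℕ) [Fact p.Prime] (x : ℚ) : x ∈ pInt p ↔ ¬ p ∣ x.den :=
  Rat.padicValuation_le_one_iff

theorem inv_mem_pInt (p : ℕ) [Fact p.Prime] (n : ℕ) (h1 : 1 ≤ n) (h2 : n < p) :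
    (n : ℚ)⁻¹ ∈ pInt p := by
  rw [mem_pInt, Rat.inv_natCast_den_of_pos (by omega)]
  exact Nat.not_dvd_of_pos_of_lt (by omega) h2

theorem bernoulli'_mem (p : ℕ) [Fact p.Prime] (n : ℕ) (h : n + 1 < p) : bernoulli' n ∈ pInt p := by
  induction n using Nat.strong_induction_on with
  | _ n ih =>
    rw [bernoulli'_def]
    refine sub_mem (one_mem _) (sum_mem fun k hk => ?_)
    rw [mem_range] at hk
    refine mul_mem ?_ (ih k hk (by omega))
    rw [div_eq_mul_inv]
    refine mul_mem (natCast_mem _ _) ?_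
    have := inv_mem_pInt p (n - k + 1) (by omega) (by omega)
    rw [Nat.cast_add, Nat.cast_sub hk.le, Nat.cast_one] at this
    exact this

theorem bernoulli_mem (p : ℕ) [Fact p.Prime] (n : ℕ) (h : n + 1 < p) : bernoulli n ∈ pInt p := by
  rw [bernoulli]
  exact mul_mem (pow_mem (neg_mem (one_mem _)) _) (bernoulli'_mem p n h)

theorem aux_Sp (m : ℕ) (hm : 1 ≤ m) [Fact (m + 2).Prime] :
    ∃ r ∈ pInt (m + 2), ∑ k ∈ range (m + 2), (k : ℚ) ^ (m + 1) =
      ((m + 2 : ℕ) : ℚ) * bernoulli (m + 1) + ((m + 2 : ℕ) : ℚ) ^ 2 * r := by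
  have hP : ((m + 2 : ℕ) : ℚ) ≠ 0 := by positivity
  refine ⟨((m + 2 : ℕ) : ℚ) ^ (m - 1) + ∑ j ∈ range m, bernoulli (j + 1) / ((j + 1 : ℕ) : ℚ) *
    ((m + 1).choose j : ℚ) * ((m + 2 : ℕ) : ℚ) ^ (m - 1 - j), ?_, ?_⟩
  · refine add_mem (pow_mem (natCast_mem _ _) _) (sum_mem fun j hj => ?_)
    rw [mem_range] at hj
    rw [div_eq_mul_inv]
    exact mul_mem (mul_mem (mul_mem (bernoulli_mem _ _ (by omega))
      (inv_mem_pInt _ _ (by omega) (by omega))) (natCast_mem _ _)) (pow_mem (natCast_mem _ _) _)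
  · rw [aux_faul, mul_add, mul_sum]
    have e : ((m + 2 : ℕ) : ℚ) ^ (m + 2) / ((m + 2 : ℕ) : ℚ)
        = ((m + 2 : ℕ) : ℚ) ^ 2 * ((m + 2 : ℕ) : ℚ) ^ (m - 1) := by
      rw [div_eq_iff hP, ← pow_add, ← pow_succ]
      congr 1
      omega
    rw [e]
    have e2 : ∀ j ∈ range m, bernoulli (j + 1) / ((j + 1 : ℕ) : ℚ) * ((m + 1).choose j : ℚ)
          * ((m + 2 : ℕ) : ℚ) ^ (m + 1 - j) = ((m + 2 : ℕ) : ℚ) ^ 2 * (bernoulli (j + 1) /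
          ((j + 1 : ℕ) : ℚ) * ((m + 1).choose j : ℚ) * ((m + 2 : ℕ) : ℚ) ^ (m - 1 - j)) := by
      intro j hj
      rw [mem_range] at hj
      have : m + 1 - j = (m - 1 - j) + 2 := by omega
      rw [this, pow_add]
      ring
    rw [sum_congr rfl e2]
    ring

theorem aux_Ma (m : ℕ) (hm : 1 ≤ m) [Fact (m + 2).Prime] (a : ℕ) (ha : 1 ≤ a) :
    ∃ r ∈ pInt (m + 2), ∑ j ∈ range m, bernoulli (j + 1) / ((j + 1 : ℕ) : ℚ) *
        ((m + 1).choose j : ℚ) * (a : ℚ) ^ (m + 1 - j) =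
      -(a : ℚ) ^ (m + 2) * (∑ j ∈ range m, bernoulli (j + 1) / (((j + 1 : ℕ) : ℚ) * (a : ℚ) ^ (j + 1)))
        - (a : ℚ) ^ (m + 1) + ((m + 2 : ℕ) : ℚ) * r := by
  have hp : (m + 2).Prime := Fact.out
  have ha0 : (a : ℚ) ≠ 0 := by positivity
  have key : ∀ j : ℕ, ∃ c : ℤ, j < m → ((m + 1).choose j : ℤ) = (-1) ^ j + ((m + 2 : ℕ) : ℤ) * c := by
    intro j
    by_cases hj : j < m
    · obtain ⟨c, hc⟩ := aux_choose (m + 2) hp j (by omega)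
      exact ⟨c, fun _ => hc⟩
    · exact ⟨0, fun h => absurd h hj⟩
  choose c hc using key
  refine ⟨∑ j ∈ range m, bernoulli (j + 1) * ((j + 1 : ℕ) : ℚ)⁻¹ * (c j : ℚ) * (a : ℚ) ^ (m + 1 - j),
    ?_, ?_⟩
  · refine sum_mem fun j hj => ?_
    rw [mem_range] at hj
    exact mul_mem (mul_mem (mul_mem (bernoulli_mem _ _ (by omega))
      (inv_mem_pInt _ _ (by omega) (by omega))) (intCast_mem _ _)) (pow_mem (natCast_mem _ _) _)
  · obtain ⟨m, rfl⟩ : ∃ l, m = l + 1 := ⟨m - 1, by omega⟩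
    have hterm : ∀ j ∈ range (m + 1), bernoulli (j + 1) / ((j + 1 : ℕ) : ℚ) *
        ((m + 1 + 1).choose j : ℚ) * (a : ℚ) ^ (m + 1 + 1 - j) =
        (-(a : ℚ) ^ (m + 1 + 2) * (bernoulli (j + 1) / (((j + 1 : ℕ) : ℚ) * (a : ℚ) ^ (j + 1)))
        + (if j = 0 then -(a : ℚ) ^ (m + 1 + 1) else 0)) + ((m + 1 + 2 : ℕ) : ℚ) *
        (bernoulli (j + 1) * ((j + 1 : ℕ) : ℚ)⁻¹ * (c j : ℚ) * (a : ℚ) ^ (m + 1 + 1 - j)) := by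
      intro j hj
      rw [mem_range] at hj
      have h1 : ((m + 1 + 1).choose j : ℚ) = (-1) ^ j + ((m + 1 + 2 : ℕ) : ℚ) * c j := by
        exact_mod_cast congrArg (Int.cast : ℤ → ℚ) (hc j hj)
      have hpow : (a : ℚ) ^ (m + 1 + 2) = (a : ℚ) ^ (m + 1 + 1 - j) * (a : ℚ) ^ (j + 1) := by
        rw [← pow_add]
        congr 1
        omega
      have hj1 : ((j + 1 : ℕ) : ℚ) ≠ 0 := by positivity
      have hpa : (a : ℚ) ^ (j + 1) ≠ 0 := by positivity
      have h3 : (a : ℚ) ^ (m + 1 + 2) * (bernoulli (j + 1) / (((j + 1 : ℕ) : ℚ) * (a : ℚ) ^ (j + 1)))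
          = bernoulli (j + 1) / ((j + 1 : ℕ) : ℚ) * (a : ℚ) ^ (m + 1 + 1 - j) := by
        rw [hpow]
        field_simp
      have h4 : bernoulli (j + 1) / ((j + 1 : ℕ) : ℚ) * (-1) ^ j * (a : ℚ) ^ (m + 1 + 1 - j) =
          -(bernoulli (j + 1) / ((j + 1 : ℕ) : ℚ) * (a : ℚ) ^ (m + 1 + 1 - j))
          + (if j = 0 then -(a : ℚ) ^ (m + 1 + 1) else 0) := by
        rcases Nat.eq_zero_or_pos j with rfl | hjp
        · norm_num [bernoulli_one]
          ring
        · rw [if_neg hjp.ne']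
          rcases Nat.even_or_odd j with he | ho
          · rw [bernoulli_eq_zero_of_odd he.add_one (by omega)]
            simp
          · rw [ho.neg_one_pow]
            ring
      rw [h1, neg_mul, h3]
      linear_combination h4
    rw [sum_congr rfl hterm, sum_add_distrib, sum_add_distrib, ← mul_sum, ← mul_sum, sum_ite_eq']
    simp
    ring

/-- `Σ_{i=1}^{p-2} B_i/(i·a^i) ≡ q_a + w_p (mod p)`. -/
theorem weighted_sum_divided_bernoulli (p : ℕ) (hp : p.Prime) (hodd : Odd p)
    (a : ℕ) (ha1 : 1 ≤ a) (ha2 : a ≤ p - 1) :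
    ratCongr p 1 (∑ i ∈ Finset.Icc 1 (p - 2), bernoulli i / (i * (a : ℚ) ^ i))
      (((((a : ℤ) ^ (p - 1) - 1) / (p : ℤ) : ℤ) : ℚ)
        + (((((Nat.factorial (p - 1) : ℕ) : ℤ) + 1) / (p : ℤ) : ℤ) : ℚ)) := by
  obtain ⟨m, rfl⟩ : ∃ m, p = m + 2 := ⟨p - 2, by have := hp.two_le; omega⟩
  have hm : 1 ≤ m := by
    rcases Nat.eq_zero_or_pos m with rfl | h
    · exact absurd hodd (by decide)
    · exact h
  have : Fact (m + 2).Prime := ⟨hp⟩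
  have hF := aux_fermat (m + 2) hp a ha1 (by omega)
  obtain ⟨c4, hc4⟩ := aux_lerch (m + 2) hp hodd
  have hsum : ∑ i ∈ Finset.Icc 1 (m + 2 - 2), bernoulli i / (i * (a : ℚ) ^ i) =
      ∑ j ∈ range m, bernoulli (j + 1) / (((j + 1 : ℕ) : ℚ) * (a : ℚ) ^ (j + 1)) := by
    rw [Finset.range_eq_Ico, Finset.sum_Ico_add' (fun i : ℕ => bernoulli i / ((i : ℚ) * (a : ℚ) ^ i)) 0 m 1]
    rfl
  have hx : m + 2 - 1 = m + 1 := by omega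
  rw [hsum]
  rw [hx] at hF hc4 ha2 ⊢
  set q : ℤ := ((a : ℤ) ^ (m + 1) - 1) / ((m + 2 : ℕ) : ℤ) with hq
  set w : ℤ := (((Nat.factorial (m + 1) : ℕ) : ℤ) + 1) / ((m + 2 : ℕ) : ℤ) with hw
  set T : ℚ := ∑ j ∈ range m, bernoulli (j + 1) / (((j + 1 : ℕ) : ℚ) * (a : ℚ) ^ (j + 1)) with hT
  set P : ℚ := ((m + 2 : ℕ) : ℚ) with hPdef
  have hP : P ≠ 0 := by rw [hPdef]; positivity
  have ha0 : (a : ℚ) ≠ 0 := by positivity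
  have hainv := inv_mem_pInt (m + 2) a ha1 (by omega)
  have hTm : T ∈ pInt (m + 2) := by
    refine sum_mem fun j hj => ?_
    rw [mem_range] at hj
    rw [div_eq_mul_inv, mul_inv, ← inv_pow]
    exact mul_mem (bernoulli_mem _ _ (by omega)) (mul_mem
      (inv_mem_pInt _ _ (by omega) (by omega)) (pow_mem hainv _))
  obtain ⟨r1, hr1, hM⟩ := aux_Ma m hm a ha1
  obtain ⟨r3, hr3, hS⟩ := aux_Sp m hm
  rw [← hPdef] at hM hS
  rw [← hT] at hM
  -- power sums in terms of Fermat quotients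
  have hpw : ∀ n : ℕ, n + 1 ≤ m + 2 → ∑ k ∈ range (n + 1), (k : ℚ) ^ (m + 1) =
      n + P * ((∑ k ∈ range n, ((((k + 1 : ℕ) : ℤ) ^ (m + 1) - 1) / ((m + 2 : ℕ) : ℤ)) : ℤ) : ℚ) := by
    intro n hn
    rw [sum_range_succ', Int.cast_sum, mul_sum]
    have : ∀ k ∈ range n, (((k + 1 : ℕ) : ℚ)) ^ (m + 1) =
        1 + P * (((((k + 1 : ℕ) : ℤ) ^ (m + 1) - 1) / ((m + 2 : ℕ) : ℤ) : ℤ) : ℚ) := by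
      intro k hk
      rw [mem_range] at hk
      exact aux_fermatQ (m + 2) hp (k + 1) (by omega) (by omega)
    rw [sum_congr rfl this, sum_add_distrib]
    simp
  have hSp := hpw (m + 1) le_rfl
  rw [hc4] at hSp
  have hSa := hpw (a - 1) (by omega)
  rw [Nat.sub_add_cancel ha1, Nat.cast_sub ha1] at hSa
  set z : ℤ := ∑ k ∈ range (a - 1), ((((k + 1 : ℕ) : ℤ) ^ (m + 1) - 1) / ((m + 2 : ℕ) : ℤ)) with hz
  rw [aux_faul, hM, ← hPdef] at hSa
  have hF' : (a : ℚ) ^ (m + 1) = 1 + P * q :=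
    aux_fermatQ (m + 2) hp a ha1 (by omega)
  have hPm : ((m + 1 : ℕ) : ℚ) = P - 1 := by rw [hPdef]; push_cast; ring
  have hc4' : (((w + ((m + 2 : ℕ) : ℤ) * c4 : ℤ)) : ℚ) = w + P * c4 := by
    rw [hPdef]; push_cast; ring
  rw [hc4', hPm] at hSp
  have hB : bernoulli (m + 1) = 1 - 1 / P + w + P * c4 - P * r3 := by
    have : P * bernoulli (m + 1) + P ^ 2 * r3 = P - 1 + P * (w + P * c4) := by
      rw [← hS]; exact hSp
    field_simp
    linear_combination this
  rw [hB, pow_succ (a : ℚ) (m + 1), hF'] at hSa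
  have hfin : (a : ℚ) * (T - (q + w)) = P * (-z + a * (c4 - r3) - a * q * T - q + r1) := by
    field_simp at hSa
    apply mul_left_cancel₀ hP
    push_cast at hSa
    linear_combination -hSa
  refine ⟨(a : ℚ)⁻¹ * (-z + a * (c4 - r3) - a * q * T - q + r1), ?_, ?_⟩
  · rw [← hPdef, pow_one]
    field_simp
    linear_combination hfin
  · rw [← mem_pInt]
    have A : (a : ℚ) ∈ pInt (m + 2) := natCast_mem _ _
    have Q : (q : ℚ) ∈ pInt (m + 2) := intCast_mem _ _
    exact mul_mem hainv (add_mem (sub_mem (sub_mem (add_mem (neg_mem (intCast_mem _ _))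
      (mul_mem A (sub_mem (intCast_mem _ _) hr3))) (mul_mem (mul_mem A Q) hTm)) Q) hr1)
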